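/- Let λ ∈ 𝒫_k, let u be a weak hook word of weak length r, and suppose u * λ = μ with μ ∈ 𝒫_k (star action on k-bounded partitions, result nonzero). Then ht(μ/λ) + ht(μ^{(k)}/λ^{(k)}) ≤ r − 1. -/

import Mathlib

open scoped BigOperators Classical

noncomputable section

namespace MN

/-! ## Residues, words, canonical cyclic intervals -/

/-- The residues `ℤ/(k+1)ℤ`. -/
abbrev Idx (k : ℕ) := ZMod (k + 1)

/-- A word in the generators, recorded by its list of indices. -/
abbrev Word (k : ℕ) := List (Idx k)

/-- The support of a word. -/
def supp (k : ℕ) (u : Word k) : Finset (Idx k) := u.toFinset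

/-- The smallest `a ∈ {0,…,k}` (as a natural number) with `(a : ℤ/(k+1)) ∉ S`. -/
def gapNat (k : ℕ) (S : Finset (Idx k)) : ℕ :=
  if h : ∃ m : ℕ, m ≤ k ∧ (m : Idx k) ∉ S then Nat.find h else 0

/-- The gap element `a` of a proper subset `S`. -/
def gap (k : ℕ) (S : Finset (Idx k)) : Idx k := (gapNat k S : Idx k)

/-- Position of a residue `i` in the canonical cyclic interval
`I_S : a+1 < a+2 < ⋯ < k < 0 < ⋯ < a−1` (the gap `a` itself gets the junk position `k`). -/
def pos (k : ℕ) (S : Finset (Idx k)) (i : Idx k) : ℕ := (i - gap k S - 1).val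

/-- The list of positions of the letters of `u` in the canonical cyclic interval of its support. -/
def posList (k : ℕ) (u : Word k) : List ℕ := u.map (pos k (supp k u))

/-- A weak hook word of hook type V:
`i₁ > ⋯ > i_j < i_{j+1} < ⋯ < i_m` with respect to `I_{supp u}`. -/
def IsHookV (k : ℕ) (u : Word k) : Prop :=
  supp k u ≠ Finset.univ ∧
    ∃ (ds as : List ℕ) (v : ℕ),
      posList k u = ds ++ v :: as ∧
        List.Chain' (· > ·) (ds ++ [v]) ∧ List.Chain' (· < ·) (v :: as)

/-- A weak hook word of hook type U:
`i₁ > ⋯ > i_j = i_{j+1} < ⋯ < i_m` with respect to `I_{supp u}`. -/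
def IsHookU (k : ℕ) (u : Word k) : Prop :=
  supp k u ≠ Finset.univ ∧
    ∃ (ds as : List ℕ) (v : ℕ),
      posList k u = ds ++ v :: v :: as ∧
        List.Chain' (· > ·) (ds ++ [v]) ∧ List.Chain' (· < ·) (v :: as)

/-- A weak hook word. -/
def IsWeakHook (k : ℕ) (u : Word k) : Prop := IsHookV k u ∨ IsHookU k u

/-- The number of ascents `i_t < i_{t+1}` of a word. -/
def asc (k : ℕ) (u : Word k) : ℕ :=
  ((posList k u).zip (posList k u).tail).countP fun p => decide (p.1 < p.2)

/-- The candidates `c` in the definition of `u_min`: letters `c` of `u` for which there is a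
letter `a` of `u` with `a < c` in `I_{supp u}`, `a + 1 ≠ c`, and no letter `b` of `u` satisfies
`a < b < c`. -/
def uminCands (k : ℕ) (u : Word k) : Finset (Idx k) :=
  (supp k u).filter fun c =>
    ∃ a ∈ supp k u,
      pos k (supp k u) a < pos k (supp k u) c ∧ a + 1 ≠ c ∧
        ∀ b ∈ supp k u,
          ¬(pos k (supp k u) a < pos k (supp k u) b ∧
            pos k (supp k u) b < pos k (supp k u) c)

/-- The letter `u_min` of `u` (junk value `0` if there is no candidate). -/
def umin (k : ℕ) (u : Word k) : Idx k :=
  if h : (uminCands k u).Nonempty then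
    ((uminCands k u).exists_min_image (pos k (supp k u)) h).choose
  else 0

/-- The number of occurrences of `u_min` in `u` (`0` if there is no candidate). -/
def uminCount (k : ℕ) (u : Word k) : ℕ :=
  if (uminCands k u).Nonempty then u.count (umin k u) else 0

/-- A set of residues is `k`-connected if it is a proper subset of `{0,…,k}` which is an
interval with respect to its canonical cyclic interval order. -/
def IsKConnectedSet (k : ℕ) (S : Finset (Idx k)) : Prop :=
  S ≠ Finset.univ ∧
    ∀ i ∈ S, ∀ j ∈ S, ∀ m : Idx k,
      pos k S i ≤ pos k S m → pos k S m ≤ pos k S j → m ∈ S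

/-- A word is `k`-connected if its support is. -/
def IsKConnected (k : ℕ) (u : Word k) : Prop := IsKConnectedSet k (supp k u)

/-- A word is `k`-weak connected if `u_min` occurs `0` or `2` times in it. -/
def IsWeakConnected (k : ℕ) (u : Word k) : Prop :=
  uminCount k u = 0 ∨ uminCount k u = 2

/-- The letter `c` lies on the left side (the maximal strictly decreasing initial segment) of
the hook form of `u`: equivalently, it occurs in some strictly decreasing initial segment. -/
def OnLeftSide (k : ℕ) (u : Word k) (c : Idx k) : Prop :=
  ∃ p q : Word k, u = p ++ q ∧
    List.Chain' (fun a b => pos k (supp k u) b < pos k (supp k u) a) p ∧ c ∈ p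

/-- The letter `c` lies on the right side (the maximal strictly increasing final segment) of
the hook form of `u`. -/
def OnRightSide (k : ℕ) (u : Word k) (c : Idx k) : Prop :=
  ∃ p q : Word k, u = p ++ q ∧
    List.Chain' (fun a b => pos k (supp k u) a < pos k (supp k u) b) q ∧ c ∈ q

/-! ## The sets `X^r_i` and their refinements (indexed by `i : ℤ`, empty for `i < 0`) -/

/-- `V^r_i`: weak hook words of hook type V, weak length `r`, `asc = i`. -/
def VSet (k r : ℕ) (i : ℤ) : Set (Word k) :=
  {u | IsHookV k u ∧ u.length = r ∧ (asc k u : ℤ) = i}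

/-- `U^r_i`. -/
def USet (k r : ℕ) (i : ℤ) : Set (Word k) :=
  {u | IsHookU k u ∧ u.length = r ∧ (asc k u : ℤ) = i}

/-- `V^r_{i,wc}`: the `k`-weak connected members of `V^r_i`. -/
def VSetWC (k r : ℕ) (i : ℤ) : Set (Word k) := {u ∈ VSet k r i | IsWeakConnected k u}

/-- `U^r_{i,wc}`. -/
def USetWC (k r : ℕ) (i : ℤ) : Set (Word k) := {u ∈ USet k r i | IsWeakConnected k u}

/-- `V^r_{i,c}`: the `k`-connected members of `V^r_i`. -/
def VSetC (k r : ℕ) (i : ℤ) : Set (Word k) := {u ∈ VSet k r i | IsKConnected k u}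

/-- `V^r_{i,w̄c,left}`. -/
def VSetNWCL (k r : ℕ) (i : ℤ) : Set (Word k) :=
  {u ∈ VSet k r i | ¬IsWeakConnected k u ∧ OnLeftSide k u (umin k u)}

/-- `V^r_{i,w̄c,right}`. -/
def VSetNWCR (k r : ℕ) (i : ℤ) : Set (Word k) :=
  {u ∈ VSet k r i | ¬IsWeakConnected k u ∧ OnRightSide k u (umin k u)}

/-- `U^r_{i,w̄c,left}`. -/
def USetNWCL (k r : ℕ) (i : ℤ) : Set (Word k) :=
  {u ∈ USet k r i | ¬IsWeakConnected k u ∧ OnLeftSide k u (umin k u)}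

/-- `U^r_{i,w̄c,right}`. -/
def USetNWCR (k r : ℕ) (i : ℤ) : Set (Word k) :=
  {u ∈ USet k r i | ¬IsWeakConnected k u ∧ OnRightSide k u (umin k u)}

/-! ## The algebras `𝒜_k`, `ℋ_k`, `𝒩_k` -/

/-- The defining relations of `𝒜_k`. -/
inductive AkRel (k : ℕ) : FreeAlgebra ℤ (Idx k) → FreeAlgebra ℤ (Idx k) → Prop
  | braid (i : Idx k) :
      AkRel k (FreeAlgebra.ι ℤ i * FreeAlgebra.ι ℤ (i + 1) * FreeAlgebra.ι ℤ i)
        (FreeAlgebra.ι ℤ (i + 1) * FreeAlgebra.ι ℤ i * FreeAlgebra.ι ℤ (i + 1))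
  | comm (i j : Idx k) (h1 : i - j ≠ 1) (h2 : j - i ≠ 1) :
      AkRel k (FreeAlgebra.ι ℤ i * FreeAlgebra.ι ℤ j)
        (FreeAlgebra.ι ℤ j * FreeAlgebra.ι ℤ i)

/-- The algebra `𝒜_k`. -/
abbrev Ak (k : ℕ) := RingQuot (AkRel k)

/-- The generator `A_i` of `𝒜_k`. -/
def Agen (k : ℕ) (i : Idx k) : Ak k := RingQuot.mkAlgHom ℤ (AkRel k) (FreeAlgebra.ι ℤ i)

/-- The element `A_{i₁} ⋯ A_{i_m}` of `𝒜_k` associated to a word. -/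
def Aword (k : ℕ) (u : Word k) : Ak k := (u.map (Agen k)).prod

/-- The defining relations of the 0-Hecke algebra `ℋ_k`. -/
inductive HkRel (k : ℕ) : FreeAlgebra ℤ (Idx k) → FreeAlgebra ℤ (Idx k) → Prop
  | braid (i : Idx k) :
      HkRel k (FreeAlgebra.ι ℤ i * FreeAlgebra.ι ℤ (i + 1) * FreeAlgebra.ι ℤ i)
        (FreeAlgebra.ι ℤ (i + 1) * FreeAlgebra.ι ℤ i * FreeAlgebra.ι ℤ (i + 1))
  | comm (i j : Idx k) (h1 : i - j ≠ 1) (h2 : j - i ≠ 1) :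
      HkRel k (FreeAlgebra.ι ℤ i * FreeAlgebra.ι ℤ j)
        (FreeAlgebra.ι ℤ j * FreeAlgebra.ι ℤ i)
  | sq (i : Idx k) :
      HkRel k (FreeAlgebra.ι ℤ i * FreeAlgebra.ι ℤ i) (-(FreeAlgebra.ι ℤ i))

/-- The 0-Hecke algebra `ℋ_k`. -/
abbrev Hk (k : ℕ) := RingQuot (HkRel k)

/-- The generator `H_i`. -/
def Hgen (k : ℕ) (i : Idx k) : Hk k := RingQuot.mkAlgHom ℤ (HkRel k) (FreeAlgebra.ι ℤ i)

/-- The element `H_{i₁} ⋯ H_{i_m}`. -/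
def Hword (k : ℕ) (u : Word k) : Hk k := (u.map (Hgen k)).prod

/-- The defining relations of the nilCoxeter algebra `𝒩_k`. -/
inductive NkRel (k : ℕ) : FreeAlgebra ℤ (Idx k) → FreeAlgebra ℤ (Idx k) → Prop
  | braid (i : Idx k) :
      NkRel k (FreeAlgebra.ι ℤ i * FreeAlgebra.ι ℤ (i + 1) * FreeAlgebra.ι ℤ i)
        (FreeAlgebra.ι ℤ (i + 1) * FreeAlgebra.ι ℤ i * FreeAlgebra.ι ℤ (i + 1))
  | comm (i j : Idx k) (h1 : i - j ≠ 1) (h2 : j - i ≠ 1) :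
      NkRel k (FreeAlgebra.ι ℤ i * FreeAlgebra.ι ℤ j)
        (FreeAlgebra.ι ℤ j * FreeAlgebra.ι ℤ i)
  | sq (i : Idx k) :
      NkRel k (FreeAlgebra.ι ℤ i * FreeAlgebra.ι ℤ i) 0

/-- The nilCoxeter algebra `𝒩_k`. -/
abbrev Nk (k : ℕ) := RingQuot (NkRel k)

/-- The generator `N_i`. -/
def Ngen (k : ℕ) (i : Idx k) : Nk k := RingQuot.mkAlgHom ℤ (NkRel k) (FreeAlgebra.ι ℤ i)

/-- The element `N_{i₁} ⋯ N_{i_m}`. -/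
def Nword (k : ℕ) (u : Word k) : Nk k := (u.map (Ngen k)).prod

/-! ## The affine symmetric group -/

/-- The relators of the affine symmetric group `S̃_{k+1}`. -/
def CoxRels (k : ℕ) : Set (FreeGroup (Idx k)) :=
  {g | (∃ i : Idx k, g = FreeGroup.of i * FreeGroup.of i) ∨
    (∃ i : Idx k,
      g = FreeGroup.of i * FreeGroup.of (i + 1) * FreeGroup.of i *
        (FreeGroup.of (i + 1) * FreeGroup.of i * FreeGroup.of (i + 1))⁻¹) ∨
    (∃ i j : Idx k, i - j ≠ 1 ∧ j - i ≠ 1 ∧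
      g = FreeGroup.of i * FreeGroup.of j * (FreeGroup.of j * FreeGroup.of i)⁻¹)}

/-- The affine symmetric group `S̃_{k+1}`. -/
abbrev AffS (k : ℕ) := PresentedGroup (CoxRels k)

/-- The generator `s_i`. -/
def sgen (k : ℕ) (i : Idx k) : AffS k := PresentedGroup.of i

/-- The product `s_{i₁} ⋯ s_{i_m}`. -/
def sword (k : ℕ) (u : Word k) : AffS k := (u.map (sgen k)).prod

/-- The Coxeter length of `w ∈ S̃_{k+1}`. -/
def len (k : ℕ) (w : AffS k) : ℕ :=
  sInf {m | ∃ u : Word k, u.length = m ∧ sword k u = w}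

/-- `u` is a reduced word. -/
def IsReducedWord (k : ℕ) (u : Word k) : Prop := len k (sword k u) = u.length

/-- The finite symmetric group `S_{k+1} = ⟨s_1, …, s_k⟩` inside `S̃_{k+1}`. -/
def FinSub (k : ℕ) : Subgroup (AffS k) :=
  Subgroup.closure {g | ∃ i : Idx k, i ≠ 0 ∧ g = sgen k i}

/-- `w` is a minimal-length coset representative of `S̃_{k+1}/S_{k+1}` (a Grassmannian
element). -/
def IsGrassmannian (k : ℕ) (w : AffS k) : Prop :=
  ∀ v : AffS k, w⁻¹ * v ∈ FinSub k → len k w ≤ len k v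

/-! ## Anti-weak hook words -/

/-- Anti-weak hook word, first form: `i₁ < ⋯ < i_j > i_{j+1} > ⋯ > i_m`. -/
def IsAntiHookV (k : ℕ) (u : Word k) : Prop :=
  supp k u ≠ Finset.univ ∧
    ∃ (ds as : List ℕ) (v : ℕ),
      posList k u = ds ++ v :: as ∧
        List.Chain' (· < ·) (ds ++ [v]) ∧ List.Chain' (· > ·) (v :: as)

/-- Anti-weak hook word, second form: `i₁ < ⋯ < i_j = i_{j+1} > ⋯ > i_m`. -/
def IsAntiHookU (k : ℕ) (u : Word k) : Prop :=
  supp k u ≠ Finset.univ ∧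
    ∃ (ds as : List ℕ) (v : ℕ),
      posList k u = ds ++ v :: v :: as ∧
        List.Chain' (· < ·) (ds ++ [v]) ∧ List.Chain' (· > ·) (v :: as)

/-- Anti-weak hook word. -/
def IsAntiWeakHook (k : ℕ) (u : Word k) : Prop := IsAntiHookV k u ∨ IsAntiHookU k u

/-- Length of the maximal strictly increasing (w.r.t. `I_{supp u}`) initial segment of `u`
(= the left side of an anti-weak hook word). -/
def incPrefixLen (k : ℕ) (u : Word k) : ℕ :=
  sSup {n | n ≤ u.length ∧
    List.Chain' (fun a b => pos k (supp k u) a < pos k (supp k u) b) (u.take n)}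

/-- Length of the maximal strictly increasing (w.r.t. `I_{supp u}`) final segment of `u`
(= the right side of a weak hook word). -/
def incSuffixLen (k : ℕ) (u : Word k) : ℕ :=
  sSup {n | n ≤ u.length ∧
    List.Chain' (fun a b => pos k (supp k u) a < pos k (supp k u) b)
      (u.drop (u.length - n))}

/-! ## Noncommutative symmetric functions in `𝒜_k` -/

/-- The word underlying the cyclically decreasing element `d_A` (letters of `A` in decreasing
position order, so that `A_{i+1}` occurs before `A_i` whenever `i, i+1 ∈ A`). -/
def dwordOf (k : ℕ) (A : Finset (Idx k)) : Word k :=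
  (((A.image (pos k A)).sort (· ≤ ·)).reverse).map fun n => gap k A + 1 + (n : Idx k)

/-- The word underlying the cyclically increasing element `i_A`. -/
def iwordOf (k : ℕ) (A : Finset (Idx k)) : Word k :=
  ((A.image (pos k A)).sort (· ≤ ·)).map fun n => gap k A + 1 + (n : Idx k)

/-- The noncommutative homogeneous symmetric function `h_r = Σ_{|A| = r} d_A`. -/
def hFun (k r : ℕ) : Ak k :=
  ∑ A ∈ Finset.powersetCard r (Finset.univ : Finset (Idx k)), Aword k (dwordOf k A)

/-- The noncommutative elementary symmetric function `e_r = Σ_{|A| = r} i_A`. -/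
def eFun (k r : ℕ) : Ak k :=
  ∑ A ∈ Finset.powersetCard r (Finset.univ : Finset (Idx k)), Aword k (iwordOf k A)

/-- The noncommutative hook Schur function `s_{(r−i,1^i)}`. -/
def sHookFun (k r i : ℕ) : Ak k :=
  ∑ j ∈ Finset.range (i + 1), ((-1 : ℤ) ^ j) • (hFun k (r - i + j) * eFun k (i - j))

/-- The noncommutative power sum `p_r`. -/
def pFun (k r : ℕ) : Ak k :=
  ∑ i ∈ Finset.range r, ((-1 : ℤ) ^ i) • sHookFun k r i

/-! ## Actions on the affine symmetric group -/

/-- The star action of a generator: `A_i * w = s_i w` if `l(s_i w) > l(w)`, else `w`. -/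
def starG (k : ℕ) (i : Idx k) (w : AffS k) : AffS k :=
  if len k w < len k (sgen k i * w) then sgen k i * w else w

/-- The star action of a word: `A_{i₁}⋯A_{i_m} * w = A_{i₁} * (⋯ * (A_{i_m} * w))`. -/
def starW (k : ℕ) (u : Word k) (w : AffS k) : AffS k := u.foldr (starG k) w

/-- The dot action of a generator, with values in `S̃_{k+1} ∪ {0}`. -/
def dotG (k : ℕ) (i : Idx k) : Option (AffS k) → Option (AffS k)
  | none => none
  | some w => if len k w < len k (sgen k i * w) then some (sgen k i * w) else none

/-- The dot action of a word. -/
def dotW (k : ℕ) (u : Word k) (o : Option (AffS k)) : Option (AffS k) :=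
  u.foldr (dotG k) o

/-- Extension of an action datum `act : generator → S̃ → S̃ ∪ {0}` to `S̃ ∪ {0}`. -/
def actExt (k : ℕ) (act : Idx k → AffS k → Option (AffS k)) (i : Idx k) :
    Option (AffS k) → Option (AffS k)
  | none => none
  | some w => act i w

/-- Extension of an action datum to words. -/
def actW (k : ℕ) (act : Idx k → AffS k → Option (AffS k)) (u : Word k)
    (o : Option (AffS k)) : Option (AffS k) :=
  u.foldr (actExt k act) o

/-! ## Rings and coefficients -/

/-- `(−1)^n` for an integer exponent `n`, in any ring. -/
def msign (R : Type*) [Ring R] (n : ℤ) : R := (((-1 : Rˣ) ^ n : Rˣ) : R)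

/-- The power sum `p^R_r = Σ_{i=0}^{r−1} Σ_{j=0}^{i} (−1)^{i+j} h^R_{r−i+j} e^R_{i−j}` built from
Pieri data in a commutative ring. -/
def pR {R : Type*} [CommRing R] (h e : ℕ → R) (r : ℕ) : R :=
  ∑ i ∈ Finset.range r, ∑ j ∈ Finset.range (i + 1),
    ((-1 : ℤ) ^ (i + j)) • (h (r - i + j) * e (i - j))

/-- The integer coefficient
`Σ_{i=0}^{r−1} (−1)^i |V^r_{i,wc} ∩ P| + Σ_{i=1}^{r−1} (−1)^i (r−i) |U^r_{i−1,wc} ∩ P|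
 + Σ_{i=1}^{r−2} (−1)^i |U^r_{i−1,w̄c,left} ∩ P|`. -/
def MNcoeff (k r : ℕ) (P : Word k → Prop) : ℤ :=
  (∑ i ∈ Finset.range r, (-1 : ℤ) ^ i * ({u ∈ VSetWC k r (i : ℤ) | P u}.ncard : ℤ)) +
    (∑ i ∈ Finset.Icc 1 (r - 1),
      (-1 : ℤ) ^ i * ((r : ℤ) - i) * ({u ∈ USetWC k r ((i : ℤ) - 1) | P u}.ncard : ℤ)) +
    ∑ i ∈ Finset.Icc 1 (r - 2),
      (-1 : ℤ) ^ i * ({u ∈ USetNWCL k r ((i : ℤ) - 1) | P u}.ncard : ℤ)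

/-- The integer coefficient `Σ_{i=0}^{r−1} (−1)^i |V^r_{i,c} ∩ P|`. -/
def kcoeff (k r : ℕ) (P : Word k → Prop) : ℤ :=
  ∑ i ∈ Finset.range r, (-1 : ℤ) ^ i * ({u ∈ VSetC k r (i : ℤ) | P u}.ncard : ℤ)

/-! ## Partitions, cores, bounded partitions -/

/-- A cell of a Young diagram: (row, column), `0`-indexed. -/
abbrev Cell := ℕ × ℕ

/-- A (finite) Young diagram, as a finite lower set of cells. -/
def IsYoung (S : Set Cell) : Prop :=
  S.Finite ∧ ∀ p ∈ S, ∀ q : Cell, q.1 ≤ p.1 → q.2 ≤ p.2 → q ∈ S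

/-- The `(k+1)`-residue of a cell `(i,j)`, i.e. `j − i mod (k+1)`. -/
def res (k : ℕ) (c : Cell) : Idx k := (c.2 : Idx k) - (c.1 : Idx k)

/-- The hook length of a cell: arm + leg + 1. -/
def hookLen (S : Set Cell) (c : Cell) : ℕ :=
  {j | c.2 < j ∧ (c.1, j) ∈ S}.ncard + {i | c.1 < i ∧ (i, c.2) ∈ S}.ncard + 1

/-- A `(k+1)`-core: a partition with no cell of hook length `k+1`. -/
def IsCore (k : ℕ) (S : Set Cell) : Prop :=
  IsYoung S ∧ ∀ c ∈ S, hookLen S c ≠ k + 1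

/-- A `k`-bounded partition: every part is at most `k`. -/
def IsBounded (k : ℕ) (S : Set Cell) : Prop :=
  IsYoung S ∧ ∀ c ∈ S, c.2 < k

/-- A removable corner of `S`. -/
def Removable (S : Set Cell) (c : Cell) : Prop :=
  c ∈ S ∧ (c.1 + 1, c.2) ∉ S ∧ (c.1, c.2 + 1) ∉ S

/-- An addable corner of `S`: a cell not in `S` whose addition yields a partition. -/
def Addable (S : Set Cell) (c : Cell) : Prop :=
  c ∉ S ∧ IsYoung (S ∪ {c})

/-- The map `𝔭` from `(k+1)`-cores to `k`-bounded partitions: row `i` of `𝔭(κ)` has as many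
cells as there are cells of hook length at most `k` in row `i` of `κ`. -/
def pMap (k : ℕ) (S : Set Cell) : Set Cell :=
  {c | c.2 < {j | (c.1, j) ∈ S ∧ hookLen S (c.1, j) ≤ k}.ncard}

/-- The inverse bijection `𝔭^{-1}` from `k`-bounded partitions to `(k+1)`-cores. -/
def pInv (k : ℕ) (lam : Set Cell) : Set Cell :=
  Function.invFunOn (pMap k) {S | IsCore k S} lam

/-- The transpose (conjugate) of a diagram. -/
def transposeSet (S : Set Cell) : Set Cell := {c | (c.2, c.1) ∈ S}

/-- The `k`-conjugate `λ^{(k)} = 𝔭((𝔭^{-1} λ)^t)`. -/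
def kconj (k : ℕ) (lam : Set Cell) : Set Cell := pMap k (transposeSet (pInv k lam))

/-- A skew shape is a ribbon if it contains no `2×2` square. -/
def IsRibbon (D : Set Cell) : Prop :=
  ∀ c : Cell, ¬((c.1, c.2) ∈ D ∧ (c.1 + 1, c.2) ∈ D ∧
    (c.1, c.2 + 1) ∈ D ∧ (c.1 + 1, c.2 + 1) ∈ D)

/-- A vertical strip: no two cells in the same row. -/
def IsVStrip (D : Set Cell) : Prop :=
  ∀ c ∈ D, ∀ c' ∈ D, c.1 = c'.1 → c = c'

/-- A horizontal strip: no two cells in the same column. -/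
def IsHStrip (D : Set Cell) : Prop :=
  ∀ c ∈ D, ∀ c' ∈ D, c.2 = c'.2 → c = c'

/-- The height of a skew shape: the number of occupied rows minus the number of connected
components; each connected component is counted by its unique last occupied row, i.e. an
occupied row sharing no column with the next row. -/
def htSkew (D : Set Cell) : ℕ :=
  {i : ℕ | ∃ j, (i, j) ∈ D}.ncard -
    {i : ℕ | (∃ j, (i, j) ∈ D) ∧ ¬∃ j, (i, j) ∈ D ∧ (i + 1, j) ∈ D}.ncard

/-- The set of `(k+1)`-residues of the cells of a skew shape. -/
def residSupp (k : ℕ) (D : Set Cell) : Finset (Idx k) :=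
  Set.Finite.toFinset (Set.toFinite (res k '' D))

/-! ## Star and dot actions on cores and on `k`-bounded partitions -/

/-- The star action of `A_i` on `(k+1)`-cores together with `0`. -/
def starC (k : ℕ) (i : Idx k) : Option (Set Cell) → Option (Set Cell)
  | none => none
  | some S =>
    if ∃ c, Addable S c ∧ res k c = i then some (S ∪ {c | Addable S c ∧ res k c = i})
    else if ∃ c, Removable S c ∧ res k c = i then some S
    else none

/-- The star action of a word on cores. -/
def starCW (k : ℕ) (u : Word k) (o : Option (Set Cell)) : Option (Set Cell) :=
  u.foldr (starC k) o

/-- The star action of a word on `k`-bounded partitions, transported through `𝔭`. -/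
def starB (k : ℕ) (u : Word k) (lam : Set Cell) : Option (Set Cell) :=
  (starCW k u (some (pInv k lam))).map (pMap k)

/-- The dot action of `A_i` on `(k+1)`-cores together with `0`. -/
def dotC (k : ℕ) (i : Idx k) : Option (Set Cell) → Option (Set Cell)
  | none => none
  | some S =>
    if ∃ c, Addable S c ∧ res k c = i then some (S ∪ {c | Addable S c ∧ res k c = i})
    else none

/-- The dot action of a word on cores. -/
def dotCW (k : ℕ) (u : Word k) (o : Option (Set Cell)) : Option (Set Cell) :=
  u.foldr (dotC k) o

/-- The dot action of a word on `k`-bounded partitions, transported through `𝔭`. -/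
def dotB (k : ℕ) (u : Word k) (lam : Set Cell) : Option (Set Cell) :=
  (dotCW k u (some (pInv k lam))).map (pMap k)

/-- The number of maximal segments of consecutive letters (w.r.t. the positions for `S`) of a
word `V`. -/
def numSegments (k : ℕ) (S : Finset (Idx k)) (V : Word k) : ℕ :=
  if V.length = 0 then 0
  else ((V.zip V.tail).countP fun p => decide (pos k S p.2 ≠ pos k S p.1 + 1)) + 1

/-- Conditions (K0)–(K4) of the Murnaghan–Nakayama rule for `K`-`k`-Schur functions. -/
def Kconds (k r : ℕ) (lam mu : Set Cell) : Prop :=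
  lam ⊆ mu ∧ kconj k lam ⊆ kconj k mu ∧
    (mu \ lam).ncard ≤ r ∧
    IsRibbon (pInv k mu \ pInv k lam) ∧
    (IsKConnectedSet k (residSupp k (pInv k mu \ pInv k lam)) ∨
      (residSupp k (pInv k mu \ pInv k lam)).card < r) ∧
    htSkew (mu \ lam) + htSkew (kconj k mu \ kconj k lam) < r

/-- Conditions (k0)–(k4) of the Murnaghan–Nakayama rule for `k`-Schur functions. -/
def kconds (k r : ℕ) (lam mu : Set Cell) : Prop :=
  lam ⊆ mu ∧ kconj k lam ⊆ kconj k mu ∧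
    (mu \ lam).ncard = r ∧
    IsRibbon (pInv k mu \ pInv k lam) ∧
    IsKConnectedSet k (residSupp k (pInv k mu \ pInv k lam)) ∧
    htSkew (mu \ lam) + htSkew (kconj k mu \ kconj k lam) = r - 1


/-! ## Proof -/

def RowOf (S : Set Cell) (a : ℕ → ℕ) : Prop :=
  Antitone a ∧ (∃ L, ∀ i, L ≤ i → a i = 0) ∧ ∀ i j, (i, j) ∈ S ↔ j < a i

lemma young_rows {S : Set Cell} (h : IsYoung S) : ∃ a, RowOf S a := by
  let Y : YoungDiagram := ⟨h.1.toFinset, by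
    intro p q hqp hp
    simp only [Set.Finite.coe_toFinset] at hp ⊢
    exact h.2 p hp q hqp.1 hqp.2⟩
  have hY : ∀ i j, (i, j) ∈ S ↔ (i, j) ∈ Y := by
    intro i j
    rw [← YoungDiagram.mem_cells]
    simp [Y]
  refine ⟨Y.rowLen, ?_, ⟨Y.colLen 0, ?_⟩, ?_⟩
  · intro i j hij
    exact Y.rowLen_anti i j hij
  · intro i hi
    by_contra hne
    have h1 : (i, 0) ∈ Y := YoungDiagram.mem_iff_lt_rowLen.2 (Nat.pos_of_ne_zero hne)
    have h2 := YoungDiagram.mem_iff_lt_colLen.1 h1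
    omega
  · intro i j
    rw [hY, YoungDiagram.mem_iff_lt_rowLen]

lemma rows_young {S : Set Cell} {a : ℕ → ℕ} (h : RowOf S a) : IsYoung S := by
  obtain ⟨ha, ⟨L, hL⟩, hS⟩ := h
  constructor
  · refine ((Set.finite_Iio L).prod (Set.finite_Iio (a 0))).subset ?_
    rintro ⟨i, j⟩ hij
    rw [hS] at hij
    have h0 := ha (Nat.zero_le i)
    have : i < L := by
      by_contra hc
      have := hL i (by omega)
      omega
    exact ⟨this, lt_of_lt_of_le hij h0⟩
  · rintro ⟨i, j⟩ hp ⟨i', j'⟩ h1 h2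
    rw [hS] at hp ⊢
    have := ha h1
    simp only at h1 h2 this
    omega

lemma young_transpose {S : Set Cell} (h : IsYoung S) : IsYoung (transposeSet S) := by
  constructor
  · exact h.1.preimage (f := fun c : Cell => (c.2, c.1)) (by
      rintro ⟨a, b⟩ - ⟨c, d⟩ - hh
      simp only [Prod.mk.injEq] at hh ⊢
      exact ⟨hh.2, hh.1⟩)
  · rintro p hp q h1 h2
    exact h.2 _ hp _ h2 h1

lemma hook_eq {S : Set Cell} {a b : ℕ → ℕ} (h : RowOf S a) (hb : RowOf (transposeSet S) b)
    (i j : ℕ) : hookLen S (i, j) = (a i - j - 1) + (b j - i - 1) + 1 := by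
  have h1 : {j' | j < j' ∧ (i, j') ∈ S} = ((Finset.Ioo j (a i) : Finset ℕ) : Set ℕ) := by
    ext x; simp [h.2.2]
  have h2 : {i' | i < i' ∧ (i', j) ∈ S} = ((Finset.Ioo i (b j) : Finset ℕ) : Set ℕ) := by
    ext x
    have := hb.2.2 j x
    simp only [transposeSet, Set.mem_setOf_eq] at this
    simp [this]
  unfold hookLen
  simp only
  rw [h1, h2, Set.ncard_coe_finset, Set.ncard_coe_finset, Nat.card_Ioo, Nat.card_Ioo]

def CR (k : ℕ) (a l : ℕ → ℕ) : Prop := ∀ i, l i ≤ k ∧ a i = l i + a (i + 1 + (k - l i))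

lemma row_col {S : Set Cell} {a b : ℕ → ℕ} (h : RowOf S a) (hb : RowOf (transposeSet S) b)
    (i j : ℕ) : i < b j ↔ j < a i := by
  rw [← h.2.2, ← hb.2.2]; rfl

lemma core_of_CR {k : ℕ} {S : Set Cell} {a l : ℕ → ℕ} (h : RowOf S a) (hc : CR k a l) :
    IsCore k S ∧ pMap k S = {c | c.2 < l c.1} := by
  have hY := rows_young h
  obtain ⟨b, hb⟩ := young_rows (young_transpose hY)
  have key : ∀ i j, j < a i → (j < a (i + 1 + (k - l i)) → k + 1 < hookLen S (i, j)) ∧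
      (a (i + 1 + (k - l i)) ≤ j → hookLen S (i, j) ≤ k) := by
    intro i j hj
    rw [hook_eq h hb]
    have h1 := row_col h hb (i + 1 + (k - l i)) j
    have h2 := row_col h hb i j
    obtain ⟨h3, h4⟩ := hc i
    constructor
    · intro h5
      have := h1.2 h5
      omega
    · intro h5
      have : ¬ (i + 1 + (k - l i) < b j) := fun hh => by have := h1.1 hh; omega
      omega
  refine ⟨⟨hY, ?_⟩, ?_⟩
  · rintro ⟨i, j⟩ hij
    rw [h.2.2] at hij
    have := key i j hij
    rcases lt_or_ge j (a (i + 1 + (k - l i))) with h5 | h5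
    · have := this.1 h5; omega
    · have := this.2 h5; omega
  · ext ⟨i, j⟩
    have : {j | (i, j) ∈ S ∧ hookLen S (i, j) ≤ k} =
        ((Finset.Ico (a (i + 1 + (k - l i))) (a i) : Finset ℕ) : Set ℕ) := by
      ext x
      simp only [Set.mem_setOf_eq, h.2.2, Finset.coe_Ico, Set.mem_Ico]
      constructor
      · rintro ⟨h1, h2⟩
        refine ⟨?_, h1⟩
        by_contra h3
        have := (key i x h1).1 (by omega)
        omega
      · rintro ⟨h1, h2⟩
        exact ⟨h2, (key i x h2).2 h1⟩
    simp only [pMap, Set.mem_setOf_eq]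
    rw [this, Set.ncard_coe_finset, Nat.card_Ico]
    have := hc i
    omega

lemma CR_iff {k : ℕ} {a : ℕ → ℕ} (ha : Antitone a) :
    (∃ l, CR k a l) ↔ ∀ i, ∃ m, a i + m = a m + i + (k + 1) := by
  constructor
  · rintro ⟨l, hl⟩ i
    have := hl i
    exact ⟨i + 1 + (k - l i), by omega⟩
  · intro h
    choose m hm using h
    have hlt : ∀ i, i < m i := by
      intro i
      by_contra hc
      have := ha (show m i ≤ i by omega)
      have := hm i
      omega
    refine ⟨fun i => a i - a (m i), fun i => ?_⟩
    have h1 := hlt i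
    have h2 := hm i
    have h3 := ha h1.le
    have h4 : i + 1 + (k - (a i - a (m i))) = m i := by omega
    simp only [h4]
    omega

lemma CR_of_core {k : ℕ} {S : Set Cell} {a : ℕ → ℕ} (hS : IsCore k S) (h : RowOf S a) :
    ∃ l, CR k a l := by
  obtain ⟨b, hb⟩ := young_rows (young_transpose hS.1)
  rw [CR_iff h.1]
  intro i
  obtain ⟨L, hL⟩ := h.2.1
  have hex : ∃ m, a m + (k + 1) + i ≤ a i + m :=
    ⟨L + (k + 1) + i, by rw [hL _ (by omega)]; omega⟩
  obtain ⟨m, hm, hmin⟩ : ∃ m, a m + (k + 1) + i ≤ a i + m ∧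
      ∀ m', m' < m → ¬ (a m' + (k + 1) + i ≤ a i + m') :=
    ⟨Nat.find hex, Nat.find_spec hex, fun m' hm' => Nat.find_min hex hm'⟩
  refine ⟨m, ?_⟩
  by_contra hne
  have him : i < m := by
    by_contra hc
    have := h.1 (show m ≤ i by omega)
    omega
  have h1 := hmin (m - 1) (by omega)
  have h2 := h.1 (show i ≤ m - 1 by omega)
  set j := a i + m - (k + 1) - i - 1 with hj
  have h3 := row_col h hb m j
  have h4 := row_col h hb (m - 1) j
  have hja : j < a (m - 1) := by omega
  have hjm : ¬ j < a m := by omega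
  have h5 := h4.2 hja
  have h6 : ¬ m < b j := fun hh => hjm (h3.1 hh)
  have h7 := hS.2 (i, j) ((h.2.2 i j).2 (by omega))
  rw [hook_eq h hb] at h7
  omega

lemma core_rows {k : ℕ} {S : Set Cell} (hS : IsCore k S) :
    ∃ a l, RowOf S a ∧ CR k a l ∧ pMap k S = {c | c.2 < l c.1} := by
  obtain ⟨a, ha⟩ := young_rows hS.1
  obtain ⟨l, hl⟩ := CR_of_core hS ha
  exact ⟨a, l, ha, hl, (core_of_CR ha hl).2⟩

lemma pMap_inj {k : ℕ} {S T : Set Cell} (hS : IsCore k S) (hT : IsCore k T)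
    (h : pMap k S = pMap k T) : S = T := by
  obtain ⟨a, l, ha, hl, hp⟩ := core_rows hS
  obtain ⟨a', l', ha', hl', hp'⟩ := core_rows hT
  have hll : l = l' := by
    funext i
    rw [hp, hp'] at h
    apply le_antisymm
    · by_contra hc
      have : (i, l' i) ∈ {c : Cell | c.2 < l c.1} := by simp only [Set.mem_setOf_eq]; omega
      rw [h] at this
      simp at this
    · by_contra hc
      have : (i, l i) ∈ {c : Cell | c.2 < l' c.1} := by simp only [Set.mem_setOf_eq]; omega
      rw [← h] at this
      simp at this
  subst hll
  obtain ⟨L, hL⟩ := ha.2.1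
  obtain ⟨L', hL'⟩ := ha'.2.1
  have key : ∀ d i, L + L' - i ≤ d → a i = a' i := by
    intro d
    induction d with
    | zero =>
      intro i hi
      rw [hL i (by omega), hL' i (by omega)]
    | succ d ih =>
      intro i hi
      rw [(hl i).2, (hl' i).2, ih _ (by omega)]
  ext ⟨i, j⟩
  rw [ha.2.2, ha'.2.2, key _ i le_rfl]

def coreRow (k : ℕ) (l : ℕ → ℕ) (L : ℕ) (i : ℕ) : ℕ :=
  if L ≤ i then 0 else l i + coreRow k l L (i + 1 + (k - l i))
termination_by L - i

lemma pMap_surj {k : ℕ} {lam : Set Cell} (h : IsBounded k lam) :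
    ∃ S, IsCore k S ∧ pMap k S = lam := by
  obtain ⟨l, hl⟩ := young_rows h.1
  have hlk : ∀ i, l i ≤ k := by
    intro i
    by_contra hc
    have := h.2 (i, k) ((hl.2.2 _ _).2 (by omega))
    simp at this
  obtain ⟨L, hL⟩ := hl.2.1
  have h0 : ∀ i, L ≤ i → coreRow k l L i = 0 := by
    intro i hi
    rw [coreRow, if_pos hi]
  have hrec : ∀ i, coreRow k l L i = l i + coreRow k l L (i + 1 + (k - l i)) := by
    intro i
    by_cases hi : L ≤ i
    · rw [h0 i hi, h0 _ (by omega), hL i hi]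
    · conv_lhs => rw [coreRow, if_neg hi]
  have hanti : ∀ d i, L - i ≤ d → ∀ j, i ≤ j → coreRow k l L j ≤ coreRow k l L i := by
    intro d
    induction d with
    | zero =>
      intro i hi j hj
      rw [h0 j (by omega)]; omega
    | succ d ih =>
      intro i hi j hj
      rw [hrec j, hrec i]
      have h1 := hl.1 hj
      have h2 := hlk i
      have := ih (i + 1 + (k - l i)) (by omega) (j + 1 + (k - l j)) (by omega)
      omega
  have hR : RowOf {c : Cell | c.2 < coreRow k l L c.1} (coreRow k l L) :=
    ⟨fun i j hij => hanti _ i le_rfl j hij, ⟨L, h0⟩, fun i j => Iff.rfl⟩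
  obtain ⟨h1, h2⟩ := core_of_CR hR (l := l) (fun i => ⟨hlk i, hrec i⟩)
  refine ⟨_, h1, ?_⟩
  rw [h2]
  ext ⟨i, j⟩
  exact (hl.2.2 i j).symm

lemma pInv_spec {k : ℕ} {lam : Set Cell} (h : IsBounded k lam) :
    IsCore k (pInv k lam) ∧ pMap k (pInv k lam) = lam := by
  have hex : ∃ S ∈ {S | IsCore k S}, pMap k S = lam := by
    obtain ⟨S, h1, h2⟩ := pMap_surj h
    exact ⟨S, h1, h2⟩
  exact ⟨Function.invFunOn_mem hex, Function.invFunOn_eq hex⟩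

/-! ### Steps -/

def addS (k : ℕ) (c : Idx k) (S : Set Cell) : Set Cell :=
  S ∪ {x | Addable S x ∧ res k x = c}

lemma starC_addS {k : ℕ} {c : Idx k} {S T : Set Cell} (h : starC k c (some S) = some T) :
    T = addS k c S := by
  unfold starC at h
  simp only at h
  split_ifs at h with h1 h2
  · exact (Option.some.inj h).symm
  · rw [← Option.some.inj h]
    unfold addS
    ext x
    simp only [Set.mem_union, Set.mem_setOf_eq]
    constructor
    · exact Or.inl
    · rintro (h3 | h3)
      · exact h3
      · exact absurd ⟨x, h3⟩ h1

lemma starCW_addS {k : ℕ} (u : Word k) {S T : Set Cell}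
    (h : starCW k u (some S) = some T) : T = u.foldr (addS k) S := by
  induction u generalizing T with
  | nil => exact (Option.some.inj h).symm
  | cons c w ih =>
    unfold starCW at h ih
    rw [List.foldr_cons] at h
    cases hw : List.foldr (starC k) (some S) w with
    | none => rw [hw] at h; simp [starC] at h
    | some T' =>
      rw [hw] at h
      rw [List.foldr_cons, ← ih hw]
      exact starC_addS h

lemma addable_iff {S : Set Cell} {a : ℕ → ℕ} (h : RowOf S a) (i j : ℕ) :
    Addable S (i, j) ↔ j = a i ∧ ∀ i', i' < i → a i < a i' := by
  constructor
  · rintro ⟨h1, h2⟩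
    rw [h.2.2] at h1
    have hmem : ((i, j) : Cell) ∈ S ∪ {(i, j)} := Or.inr rfl
    have hj : j = a i := by
      by_contra hne
      rcases h2.2 _ hmem (i, a i) le_rfl (by simp only; omega) with h3 | h3
      · rw [h.2.2] at h3; omega
      · simp only [Set.mem_singleton_iff, Prod.mk.injEq] at h3
        omega
    refine ⟨hj, fun i' hi' => ?_⟩
    rcases h2.2 _ hmem (i', j) hi'.le le_rfl with h3 | h3
    · rw [h.2.2] at h3; omega
    · simp only [Set.mem_singleton_iff, Prod.mk.injEq] at h3
      omega
  · rintro ⟨rfl, h2⟩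
    have hY := rows_young h
    refine ⟨by rw [h.2.2]; omega, hY.1.union (Set.finite_singleton _), ?_⟩
    rintro p (hp | hp) ⟨i', j'⟩ h3 h4
    · exact Or.inl (hY.2 p hp _ h3 h4)
    · rw [Set.mem_singleton_iff] at hp
      subst hp
      simp only at h3 h4
      rcases lt_or_eq_of_le h3 with h5 | h5
      · left
        rw [h.2.2]
        have := h2 _ h5
        omega
      · subst h5
        rcases lt_or_eq_of_le h4 with h6 | h6
        · left; rw [h.2.2]; exact h6
        · right; rw [h6]; rfl

/-- Rows receiving a cell. -/
def RR (k : ℕ) (c : Idx k) (a : ℕ → ℕ) (i : ℕ) : Prop :=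
  (∀ i', i' < i → a i < a i') ∧ ((a i : ℕ) : Idx k) - (i : Idx k) = c

def stepRow (k : ℕ) (c : Idx k) (a : ℕ → ℕ) (i : ℕ) : ℕ := if RR k c a i then a i + 1 else a i

lemma stepRow_pos {k : ℕ} {c : Idx k} {a : ℕ → ℕ} {i : ℕ} (h : RR k c a i) :
    stepRow k c a i = a i + 1 := if_pos h

lemma stepRow_neg {k : ℕ} {c : Idx k} {a : ℕ → ℕ} {i : ℕ} (h : ¬ RR k c a i) :
    stepRow k c a i = a i := if_neg h

lemma stepRow_bd (k : ℕ) (c : Idx k) (a : ℕ → ℕ) (i : ℕ) :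
    a i ≤ stepRow k c a i ∧ stepRow k c a i ≤ a i + 1 := by
  unfold stepRow; split_ifs <;> omega

lemma rowOf_step {k : ℕ} {c : Idx k} {S : Set Cell} {a : ℕ → ℕ} (h : RowOf S a) :
    RowOf (addS k c S) (stepRow k c a) := by
  refine ⟨?_, ?_, ?_⟩
  · intro i j hij
    rcases eq_or_lt_of_le hij with rfl | hlt
    · exact le_rfl
    have h1 := h.1 hij
    have h2 := stepRow_bd k c a i
    by_cases hj : RR k c a j
    · rw [stepRow_pos hj]
      have := hj.1 i hlt
      omega
    · rw [stepRow_neg hj]; omega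
  · obtain ⟨L, hL⟩ := h.2.1
    refine ⟨L + 1, fun i hi => ?_⟩
    rw [stepRow_neg, hL i (by omega)]
    intro hR
    have := hR.1 L (by omega)
    rw [hL L le_rfl] at this
    omega
  · intro i j
    unfold addS
    simp only [Set.mem_union, Set.mem_setOf_eq, h.2.2, addable_iff h, res]
    by_cases hR : RR k c a i
    · rw [stepRow_pos hR]
      constructor
      · rintro (h1 | ⟨⟨rfl, -⟩, -⟩) <;> omega
      · intro h1
        rcases Nat.lt_succ_iff_lt_or_eq.1 h1 with h2 | h2
        · exact Or.inl h2
        · right; subst h2; exact ⟨⟨rfl, hR.1⟩, hR.2⟩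
    · rw [stepRow_neg hR]
      constructor
      · rintro (h1 | ⟨⟨rfl, h1⟩, h2⟩)
        · exact h1
        · exact absurd ⟨h1, h2⟩ hR
      · exact Or.inl

lemma rs_eq {k : ℕ} {a : ℕ → ℕ} {i m : ℕ} (h : a i + m = a m + i + (k + 1)) :
    ((a i : ℕ) : Idx k) - (i : Idx k) = ((a m : ℕ) : Idx k) - (m : Idx k) := by
  have h1 := congrArg (Nat.cast : ℕ → Idx k) h
  have h2 : ((k + 1 : ℕ) : Idx k) = 0 := ZMod.natCast_self (k + 1)
  rw [Nat.cast_add, Nat.cast_add, Nat.cast_add, h2] at h1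
  linear_combination h1

lemma one_ne (k : ℕ) (hk : 1 ≤ k) : (1 : Idx k) ≠ 0 := by
  haveI : Fact (1 < k + 1) := ⟨by omega⟩
  exact one_ne_zero

lemma CR_step {k : ℕ} (hk : 1 ≤ k) {c : Idx k} {a l : ℕ → ℕ} (ha : Antitone a)
    (ha' : Antitone (stepRow k c a)) (hl : CR k a l) : ∃ l', CR k (stepRow k c a) l' := by
  have hE := (CR_iff ha).1 ⟨l, hl⟩
  rw [CR_iff ha']
  intro i
  obtain ⟨m, hm⟩ := hE i
  have him : i < m := by
    by_contra hc
    have := ha (show m ≤ i by omega)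
    omega
  have hrs := rs_eq hm
  by_cases hi : RR k c a i
  · by_cases hmR : RR k c a m
    · exact ⟨m, by rw [stepRow_pos hi, stepRow_pos hmR]; omega⟩
    · have hP : ∃ i', i' < m ∧ a i' ≤ a m := by
        by_contra hc
        push Not at hc
        exact hmR ⟨hc, hrs ▸ hi.2⟩
      obtain ⟨i', hi', hai'⟩ := hP
      have h1 := ha (show i' ≤ m - 1 by omega)
      have h2 := ha (show m - 1 ≤ m by omega)
      have h3 : a (m - 1) = a m := by omega
      refine ⟨m - 1, ?_⟩
      have h4 : ¬ RR k c a (m - 1) := by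
        intro hR
        have h5 := hR.2
        rw [h3, Nat.cast_sub (by omega)] at h5
        have h6 := hi.2
        rw [hrs] at h6
        apply one_ne k hk
        push_cast at h5
        linear_combination h5 - h6
      rw [stepRow_pos hi, stepRow_neg h4]
      omega
  · refine ⟨m, ?_⟩
    have hmR : ¬ RR k c a m := by
      intro hR
      apply hi
      refine ⟨?_, hrs.trans hR.2⟩
      by_contra hc
      push Not at hc
      obtain ⟨i', hi', hai'⟩ := hc
      have h1 := ha (show i' ≤ i - 1 by omega)
      have h2 := ha (show i - 1 ≤ i by omega)
      obtain ⟨m', hm'⟩ := hE (i - 1)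
      have h3 : m' < m := by
        by_contra hc
        have := ha (show m ≤ m' by omega)
        omega
      have := hR.1 m' h3
      omega
    rw [stepRow_neg hi, stepRow_neg hmR]; exact hm

lemma core_step {k : ℕ} (hk : 1 ≤ k) {c : Idx k} {S : Set Cell} (h : IsCore k S) :
    IsCore k (addS k c S) := by
  obtain ⟨a, l, ha, hl, hp⟩ := core_rows h
  have h1 := rowOf_step (c := c) ha
  obtain ⟨l', hl'⟩ := CR_step hk ha.1 h1.1 hl
  exact (core_of_CR h1 hl').1

lemma core_steps {k : ℕ} (hk : 1 ≤ k) (w : Word k) {S : Set Cell} (h : IsCore k S) :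
    IsCore k (w.foldr (addS k) S) := by
  induction w with
  | nil => exact h
  | cons c w ih => exact core_step hk ih

lemma down_closed {k : ℕ} {a : ℕ → ℕ} (hE : ∀ i, ∃ m, a i + m = a m + i + (k + 1))
    (t : ℕ) (i : ℕ) : ∃ m, a i + m = a m + i + t * (k + 1) := by
  induction t with
  | zero => exact ⟨i, by omega⟩
  | succ t ih =>
    obtain ⟨m, hm⟩ := ih
    obtain ⟨m', hm'⟩ := hE m
    refine ⟨m', ?_⟩
    rw [Nat.succ_mul]
    omega

lemma step_unique {k : ℕ} {c : Idx k} {a l l' : ℕ → ℕ} (ha : Antitone a)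
    (ha' : Antitone (stepRow k c a)) (hl : CR k a l) (hl' : CR k (stepRow k c a) l')
    {i : ℕ} (h : l i < l' i) :
    l' i = l i + 1 ∧ RR k c a i ∧ ∀ i2, i < i2 → ¬ RR k c a i2 := by
  obtain ⟨h1, h2⟩ := hl i
  obtain ⟨h3, h4⟩ := hl' i
  set m := i + 1 + (k - l i) with hm
  set m' := i + 1 + (k - l' i) with hm'
  have h5 := ha (show m' ≤ m by omega)
  have h6 := stepRow_bd k c a m'
  have h7 := stepRow_bd k c a i
  have hR : RR k c a i := by
    by_contra hc
    rw [stepRow_neg hc] at h4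
    omega
  have h8 : m' = m - 1 := by omega
  have h9 : a (m - 1) = a m := by
    rw [← h8]; omega
  refine ⟨by omega, hR, ?_⟩
  intro i2 hi2 hR2
  have h10 := hR.2.trans hR2.2.symm
  have h11 := hR2.1 i hi2
  have h12 : (((a i : ℤ) - i : ℤ) : ZMod (k + 1)) = (((a i2 : ℤ) - i2 : ℤ) : ZMod (k + 1)) := by
    push_cast; exact h10
  rw [ZMod.intCast_eq_intCast_iff_dvd_sub] at h12
  obtain ⟨t, ht⟩ := h12
  have ht' : ((a i : ℤ) - i) - ((a i2 : ℤ) - i2) = (-t) * ((k + 1 : ℕ) : ℤ) := by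
    linear_combination -ht
  have htpos : 0 < -t := by
    by_contra hc
    have : (-t) * ((k + 1 : ℕ) : ℤ) ≤ 0 :=
      mul_nonpos_of_nonpos_of_nonneg (by omega) (by positivity)
    omega
  obtain ⟨s, hs⟩ : ∃ s : ℕ, -t = (s : ℤ) + 1 := ⟨(-t - 1).toNat, by omega⟩
  rw [hs, add_mul, one_mul] at ht'
  obtain ⟨q, hq⟩ := down_closed ((CR_iff ha).1 ⟨l, hl⟩) s (m - 1)
  have hq' : (a (m - 1) : ℤ) + q = a q + ((m - 1 : ℕ) : ℤ) + (s : ℤ) * ((k + 1 : ℕ) : ℤ) := by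
    exact_mod_cast hq
  generalize (s : ℤ) * ((k + 1 : ℕ) : ℤ) = X at *
  have e1 : (a q : ℤ) - q = (a i2 : ℤ) - i2 + 1 := by
    rw [h9] at hq'
    omega
  have hlt : q < i2 := by
    by_contra hc
    have := ha (show i2 ≤ q by omega)
    omega
  have := hR2.1 q hlt
  omega

lemma step_encard {k : ℕ} (hk : 1 ≤ k) {c : Idx k} {S : Set Cell} (h : IsCore k S) :
    (pMap k (addS k c S) \ pMap k S).encard ≤ 1 := by
  obtain ⟨a, l, ha, hl, hp⟩ := core_rows h
  have h1 := rowOf_step (c := c) ha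
  obtain ⟨l', hl'⟩ := CR_step hk ha.1 h1.1 hl
  rw [(core_of_CR h1 hl').2, hp, Set.encard_le_one_iff]
  rintro ⟨i, j⟩ ⟨i2, j2⟩ ⟨h2, h3⟩ ⟨h4, h5⟩
  simp only [Set.mem_setOf_eq, not_lt] at h2 h3 h4 h5
  have u1 := step_unique ha.1 h1.1 hl hl' (i := i) (by omega)
  have u2 := step_unique ha.1 h1.1 hl hl' (i := i2) (by omega)
  rcases lt_trichotomy i i2 with h6 | h6 | h6
  · exact absurd u2.2.1 (u1.2.2 _ h6)
  · subst h6
    rw [Prod.mk.injEq]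
    exact ⟨rfl, by omega⟩
  · exact absurd u1.2.1 (u2.2.2 _ h6)

lemma steps_encard {k : ℕ} (hk : 1 ≤ k) (w : Word k) {S : Set Cell} (h : IsCore k S) :
    (pMap k (w.foldr (addS k) S) \ pMap k S).encard ≤ w.length := by
  induction w with
  | nil => simp
  | cons c w ih =>
    rw [List.foldr_cons, List.length_cons]
    set T := w.foldr (addS k) S with hT
    have hTc : IsCore k T := core_steps hk w h
    have hsub : pMap k (addS k c T) \ pMap k S ⊆
        (pMap k T \ pMap k S) ∪ (pMap k (addS k c T) \ pMap k T) := by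
      rintro x ⟨hx1, hx2⟩
      by_cases hx : x ∈ pMap k T
      · exact Or.inl ⟨hx, hx2⟩
      · exact Or.inr ⟨hx1, hx⟩
    refine (Set.encard_le_encard hsub).trans ((Set.encard_union_le _ _).trans ?_)
    push_cast
    exact add_le_add ih (step_encard hk hTc)

lemma strip_pMap {k : ℕ} {S T : Set Cell} (hS : IsCore k S) (hT : IsCore k T) (hST : S ⊆ T)
    (h : ∀ i j, (i + 1, j) ∈ T → (i, j) ∈ S) (i j : ℕ) (hij : (i + 1, j) ∈ pMap k T) :
    (i, j) ∈ pMap k S := by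
  obtain ⟨a, l, ha, hl, hp⟩ := core_rows hS
  obtain ⟨a', l', ha', hl', hp'⟩ := core_rows hT
  rw [hp'] at hij
  rw [hp]
  simp only [Set.mem_setOf_eq] at hij ⊢
  have hle : ∀ i, a i ≤ a' i := by
    intro i
    by_contra hc
    have := hST ((ha.2.2 i (a' i)).2 (by omega))
    rw [ha'.2.2] at this
    omega
  have hst : a' (i + 1) ≤ a i := by
    by_contra hc
    have := h i (a i) ((ha'.2.2 _ _).2 (by omega))
    rw [ha.2.2] at this
    omega
  obtain ⟨h1, h2⟩ := hl i
  obtain ⟨h3, h4⟩ := hl' (i + 1)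
  by_contra hc
  have h5 := ha.1 (show i + 1 + 1 + (k - l' (i + 1)) ≤ i + 1 + (k - l i) by omega)
  have h6 := hle (i + 1 + 1 + (k - l' (i + 1)))
  omega

lemma subset_steps {k : ℕ} (w : Word k) (S : Set Cell) : S ⊆ w.foldr (addS k) S := by
  induction w with
  | nil => exact subset_rfl
  | cons c w ih => exact ih.trans Set.subset_union_left

lemma steps_res {k : ℕ} (w : Word k) {S : Set Cell} {x : Cell}
    (hx : x ∈ w.foldr (addS k) S) (hxS : x ∉ S) : res k x ∈ w := by
  induction w with
  | nil => exact absurd hx hxS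
  | cons c w ih =>
    rcases hx with hx | hx
    · exact List.mem_cons_of_mem _ (ih hx)
    · rw [hx.2]; exact List.mem_cons_self

lemma steps_strip {k : ℕ} (w : Word k) (hw : w.Pairwise fun c d => d ≠ c + 1) {S : Set Cell}
    (hS : IsYoung S) (i j : ℕ) (h : (i + 1, j) ∈ w.foldr (addS k) S) : (i, j) ∈ S := by
  induction w with
  | nil => exact hS.2 _ h _ (Nat.le_succ i) le_rfl
  | cons c w ih =>
    rw [List.pairwise_cons] at hw
    rcases h with h | ⟨h, hc⟩
    · exact ih hw.2 h
    · by_contra hn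
      have h1 : (i, j) ∈ w.foldr (addS k) S := by
        rcases h.2.2 (i + 1, j) (Or.inr rfl) (i, j) (Nat.le_succ i) le_rfl with h2 | h2
        · exact h2
        · simp at h2
      apply hw.1 _ (steps_res w h1 hn)
      rw [← hc]
      simp only [res]
      push_cast
      ring

/-! ### Transposition -/

lemma tt (S : Set Cell) : transposeSet (transposeSet S) = S := rfl

lemma core_transpose {k : ℕ} {S : Set Cell} (h : IsCore k S) : IsCore k (transposeSet S) := by
  refine ⟨young_transpose h.1, ?_⟩
  rintro ⟨i, j⟩ hc
  have := h.2 (j, i) hc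
  have he : hookLen (transposeSet S) (i, j) = hookLen S (j, i) := by
    unfold hookLen
    simp only [transposeSet, Set.mem_setOf_eq]
    omega
  rwa [he]

lemma addable_transpose {S : Set Cell} (c : Cell) (h : Addable S c) :
    Addable (transposeSet S) (c.2, c.1) := by
  refine ⟨h.1, ?_⟩
  have := young_transpose h.2
  have he : transposeSet (S ∪ {c}) = transposeSet S ∪ {(c.2, c.1)} := by
    ext ⟨i, j⟩
    obtain ⟨x, y⟩ := c
    simp only [transposeSet, Set.mem_setOf_eq, Set.mem_union, Set.mem_singleton_iff,
      Prod.mk.injEq]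
    tauto
  rwa [he] at this

lemma addS_transpose {k : ℕ} (c : Idx k) (S : Set Cell) :
    transposeSet (addS k c S) = addS k (-c) (transposeSet S) := by
  ext ⟨i, j⟩
  simp only [addS, transposeSet, Set.mem_setOf_eq, Set.mem_union]
  have h1 : Addable S (j, i) ↔ Addable {c : Cell | (c.2, c.1) ∈ S} (i, j) :=
    ⟨fun h => addable_transpose _ h, fun h => addable_transpose (S := transposeSet S) _ h⟩
  have h2 : res k (j, i) = c ↔ res k (i, j) = -c := by
    simp only [res]
    constructor <;> intro h
    · linear_combination -h
    · linear_combination -h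
  rw [h1, h2]

lemma steps_transpose {k : ℕ} (w : Word k) (S : Set Cell) :
    transposeSet (w.foldr (addS k) S) = (w.map (- ·)).foldr (addS k) (transposeSet S) := by
  induction w with
  | nil => rfl
  | cons c w ih => rw [List.foldr_cons, addS_transpose, ih]; rfl

/-! ### Heights -/

lemma ht_le {D E : Set Cell} {n : ℕ} (hE : E.encard ≤ n) (f : Cell → ℕ)
    (h : ∀ i j, (i, j) ∈ D → (i + 1, j) ∈ D → ∃ c ∈ E, f c = i) : htSkew D ≤ n := by
  unfold htSkew
  set A := {i : ℕ | ∃ j, (i, j) ∈ D} with hA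
  set B := {i : ℕ | (∃ j, (i, j) ∈ D) ∧ ¬∃ j, (i, j) ∈ D ∧ (i + 1, j) ∈ D} with hB
  by_cases hfin : A.Finite
  · have hBA : B ⊆ A := fun i hi => hi.1
    have hBf := hfin.subset hBA
    have hEf : E.Finite := Set.finite_of_encard_le_coe hE
    have hsub : A ⊆ f '' E ∪ B := by
      intro i hi
      by_cases hh : ∃ j, (i, j) ∈ D ∧ (i + 1, j) ∈ D
      · obtain ⟨j, h1, h2⟩ := hh
        obtain ⟨c, hc, hfc⟩ := h i j h1 h2
        exact Or.inl ⟨c, hc, hfc⟩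
      · exact Or.inr ⟨hi, hh⟩
    have h1 := Set.ncard_le_ncard hsub ((hEf.image f).union hBf)
    have h2 := Set.ncard_union_le (f '' E) B
    have h3 := Set.ncard_image_le (f := f) hEf
    have h4 : E.ncard ≤ n := by
      rw [← hEf.cast_ncard_eq] at hE
      exact_mod_cast hE
    omega
  · have : A.ncard = 0 := Set.Infinite.ncard hfin
    omega

lemma main_bound {k : ℕ} (hk : 1 ≤ k) {K : Set Cell} (hK : IsCore k K) (D M A : Word k)
    (h1 : (D ++ M).Pairwise fun c d => d ≠ c + 1) (h2 : (M ++ A).Pairwise fun c d => d ≠ c - 1) :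
    htSkew (pMap k ((D ++ M ++ A).foldr (addS k) K) \ pMap k K) ≤ A.length ∧
    htSkew (pMap k (transposeSet ((D ++ M ++ A).foldr (addS k) K)) \
      pMap k (transposeSet K)) ≤ D.length := by
  constructor
  · rw [List.foldr_append]
    set N := A.foldr (addS k) K with hN
    have hNc : IsCore k N := core_steps hk A hK
    refine ht_le (steps_encard hk A hK) Prod.fst ?_
    intro i j hi hi1
    refine ⟨(i, j), ⟨?_, hi.2⟩, rfl⟩
    exact strip_pMap hNc (core_steps hk _ hNc) (subset_steps _ _)
      (steps_strip _ h1 hNc.1) i j hi1.1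
  · rw [List.append_assoc, List.foldr_append, steps_transpose D]
    set N := (M ++ A).foldr (addS k) K with hN
    have hNc : IsCore k (transposeSet N) := core_transpose (core_steps hk _ hK)
    have hKt := core_transpose hK
    have hNt : transposeSet N = ((M ++ A).map (- ·)).foldr (addS k) (transposeSet K) :=
      steps_transpose _ _
    have hen := steps_encard hk (D.map (- ·)) hNc
    rw [List.length_map] at hen
    refine ht_le hen (fun c => c.1 - 1) ?_
    intro i j hi hi1
    refine ⟨(i + 1, j), ⟨hi1.1, ?_⟩, by simp⟩
    intro hmem
    apply hi.2
    refine strip_pMap hKt hNc ?_ ?_ i j hmem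
    · rw [hNt]; exact subset_steps _ _
    · rw [hNt]
      apply steps_strip _ _ hKt.1
      rw [List.pairwise_map]
      refine h2.imp ?_
      intro c d hcd he
      apply hcd
      linear_combination -he

lemma gap_notMem {k : ℕ} {S : Finset (Idx k)} (h : S ≠ Finset.univ) : gap k S ∉ S := by
  have hex : ∃ m : ℕ, m ≤ k ∧ (m : Idx k) ∉ S := by
    by_contra hc
    push Not at hc
    apply h
    ext x
    simp only [Finset.mem_univ, iff_true]
    have := hc x.val (Nat.lt_succ_iff.1 (ZMod.val_lt x))
    rwa [ZMod.natCast_zmod_val] at this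
  unfold gap gapNat
  rw [dif_pos hex]
  exact (Nat.find_spec hex).2

lemma pos_succ {k : ℕ} {S : Finset (Idx k)} (h : S ≠ Finset.univ) {c : Idx k} (hc : c ∈ S) :
    pos k S c < pos k S (c + 1) := by
  unfold pos
  have hne : c - gap k S ≠ 0 := by
    intro h0
    have := gap_notMem h
    rw [← sub_eq_zero.1 h0] at this
    exact this hc
  have e : c + 1 - gap k S - 1 = c - gap k S := by ring
  rw [e]
  set x := c - gap k S with hx
  have h1 : x.val ≠ 0 := by rwa [Ne, ZMod.val_eq_zero]
  have h2 := ZMod.val_lt x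
  have h3 : x - 1 = ((x.val - 1 : ℕ) : Idx k) := by
    rw [Nat.cast_sub (by omega), ZMod.natCast_zmod_val]; simp
  rw [h3, ZMod.val_natCast_of_lt (by omega)]
  omega

lemma main_pos {k : ℕ} (hk : 1 ≤ k) {K : Set Cell} (hK : IsCore k K) (u : Word k)
    (hu : supp k u ≠ Finset.univ) (ds ms as : List ℕ) (hms : ms ≠ [])
    (hp : posList k u = ds ++ ms ++ as) (h1 : (ds ++ ms).Pairwise (· ≥ ·))
    (h2 : (ms ++ as).Pairwise (· ≤ ·)) :
    htSkew (pMap k (u.foldr (addS k) K) \ pMap k K) +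
    htSkew (pMap k (transposeSet (u.foldr (addS k) K)) \
      pMap k (transposeSet K)) ≤ u.length - 1 := by
  unfold posList at hp
  rw [List.map_eq_append_iff] at hp
  obtain ⟨DM, A, hu1, hDM, rfl⟩ := hp
  rw [List.map_eq_append_iff] at hDM
  obtain ⟨D, M, rfl, rfl, rfl⟩ := hDM
  have hmem : ∀ x ∈ D ++ M ++ A, x ∈ supp k u := by
    intro x hx
    rw [← hu1] at hx
    simpa [supp] using hx
  rw [← List.map_append, List.pairwise_map] at h1 h2
  have hM : M.length ≠ 0 := by
    intro h0
    rw [List.length_eq_zero_iff] at h0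
    subst h0
    exact hms rfl
  have := main_bound hk hK D M A
    (h1.imp_of_mem (by
      intro c d hc hd hcd he
      subst he
      have := pos_succ hu (hmem c (List.mem_append_left _ hc))
      omega))
    (h2.imp_of_mem (by
      intro c d hc hd hcd he
      have := pos_succ hu (hmem d (by simp only [List.mem_append] at hd ⊢; tauto))
      rw [he, sub_add_cancel] at this
      rw [he] at hcd
      omega))
  have hlen : u.length = D.length + M.length + A.length := by
    rw [hu1]; simp only [List.length_append]
  rw [← hu1] at this
  omega

lemma pw_ge {ds : List ℕ} {v : ℕ} (h : List.IsChain (· > ·) (ds ++ [v])) :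
    (ds ++ [v]).Pairwise (· ≥ ·) := h.pairwise.imp fun hh => le_of_lt hh

lemma pw_le {as : List ℕ} {v : ℕ} (h : List.IsChain (· < ·) (v :: as)) :
    (v :: as).Pairwise (· ≤ ·) := h.pairwise.imp fun hh => le_of_lt hh

theorem statement15 (k : ℕ) (hk : 1 ≤ k) (lam : Set Cell) (hlam : IsBounded k lam)
    (u : Word k) (hu : IsWeakHook k u) (r : ℕ) (hr : u.length = r)
    (mu : Set Cell) (hmu : IsBounded k mu) (huact : starB k u lam = some mu) :
    htSkew (mu \ lam) + htSkew (kconj k mu \ kconj k lam) ≤ r - 1 := by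
  obtain ⟨hc, hp⟩ := pInv_spec hlam
  obtain ⟨hc', hp'⟩ := pInv_spec hmu
  unfold starB at huact
  rw [Option.map_eq_some_iff] at huact
  obtain ⟨K1, hK1, hmuK⟩ := huact
  have hKe := starCW_addS u hK1
  have hK1c : IsCore k K1 := hKe ▸ core_steps hk u hc
  have hinv : pInv k mu = K1 := pMap_inj hc' hK1c (hp'.trans hmuK.symm)
  have goal' : htSkew (pMap k (u.foldr (addS k) (pInv k lam)) \ pMap k (pInv k lam)) +
      htSkew (pMap k (transposeSet (u.foldr (addS k) (pInv k lam))) \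
        pMap k (transposeSet (pInv k lam))) ≤ u.length - 1 := by
    rcases hu with ⟨hs, ds, as, v, h1, h2, h3⟩ | ⟨hs, ds, as, v, h1, h2, h3⟩
    · exact main_pos hk hc u hs ds [v] as (by simp) (by simpa using h1) (pw_ge h2) (pw_le h3)
    · refine main_pos hk hc u hs ds [v, v] as (by simp) (by simpa using h1) ?_ ?_
      · have := pw_ge h2
        simp only [List.pairwise_append, List.pairwise_cons, List.mem_cons] at this ⊢
        simp at this ⊢
        exact this
      · have := pw_le h3
        simp at this ⊢
        exact this
  rw [← hKe, hp, hmuK, hr] at goal'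
  unfold kconj
  rw [hinv]
  exact goal'

end MN

end
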